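/- Let q be a prime power, v a monic irreducible polynomial in 𝔽_q[t], n an odd positive integer, and s_1, …, s_n pairwise distinct q-even integers. Then Σ_{σ ∈ S_n} sgn(σ)·ζ_v^⋆(s_{σ(1)}, …, s_{σ(n)}) = 0 in K_v, where S_n is the symmetric group on {1, …, n} and sgn(σ) ∈ {±1} is viewed in K_v via the canonical ring map from ℤ. -/

import Mathlib

noncomputable section

open scoped Classical

/-- The height-one prime of `F[t]` attached to an irreducible polynomial `v`. -/
def heightOneOf {F : Type*} [Field F] (v : Polynomial F) (hv : Irreducible v) :
    IsDedekindDomain.HeightOneSpectrum (Polynomial F) where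
  asIdeal := Ideal.span {v}
  isPrime := (Ideal.span_singleton_prime hv.ne_zero).mpr hv.prime
  ne_bot := fun h => hv.ne_zero (Ideal.span_singleton_eq_bot.mp h)

/-- The `v`-adic completion `K_v` of `K = F(t)`. -/
def Kv {F : Type*} [Field F] (v : Polynomial F) (hv : Irreducible v) : Type _ :=
  (heightOneOf v hv).adicCompletion (RatFunc F)

instance {F : Type*} [Field F] (v : Polynomial F) (hv : Irreducible v) : Field (Kv v hv) :=
  inferInstanceAs (Field ((heightOneOf v hv).adicCompletion (RatFunc F)))

instance {F : Type*} [Field F] (v : Polynomial F) (hv : Irreducible v) :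
    UniformSpace (Kv v hv) :=
  inferInstanceAs (UniformSpace ((heightOneOf v hv).adicCompletion (RatFunc F)))

instance {F : Type*} [Field F] (v : Polynomial F) (hv : Irreducible v) :
    Algebra (RatFunc F) (Kv v hv) :=
  inferInstanceAs (Algebra (RatFunc F) ((heightOneOf v hv).adicCompletion (RatFunc F)))

/-- `S̃_d(k) = Σ_{a monic of degree d, v ∤ a} a^{-k} ∈ F(t)`. -/
def Stilde {F : Type*} [Field F] (v : Polynomial F) (d : ℕ) (k : ℤ) : RatFunc F :=
  ∑ᶠ a ∈ {a : Polynomial F | a.Monic ∧ a.natDegree = d ∧ ¬ v ∣ a},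
    (algebraMap (Polynomial F) (RatFunc F) a) ^ (-k)

/-- The general term of the series defining the `v`-adic multiple zeta value of the
tuple `w`, indexed by weakly decreasing tuples `d₁ ≥ ⋯ ≥ d_r ≥ 0`. -/
def zetavStarTerm {F : Type*} [Field F] (v : Polynomial F) (hv : Irreducible v) (w : List ℤ)
    (d : {d : Fin w.length → ℕ // Antitone d}) : Kv v hv :=
  algebraMap (RatFunc F) (Kv v hv) (∏ i, Stilde v (d.1 i) (w.get i))

/-- The `v`-adic multiple zeta star value `ζ_v^⋆(s₁, …, s_r) ∈ K_v`. -/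
def zetavStar {F : Type*} [Field F] (v : Polynomial F) (hv : Irreducible v) (w : List ℤ) :
    Kv v hv :=
  ∑' d : {d : Fin w.length → ℕ // Antitone d}, zetavStarTerm v hv w d

/-! ### Combinatorics: strictly decreasing sums in the exterior algebra -/

/-- strictly decreasing tuples with entries below `N` -/
def saSet (m N : ℕ) : Finset (Fin m → ℕ) :=
  (Fintype.piFinset fun _ => Finset.range N).filter StrictAnti

/-- weakly decreasing tuples with entries below `N` -/
def atSet (m N : ℕ) : Finset (Fin m → ℕ) :=
  (Fintype.piFinset fun _ => Finset.range N).filter Antitone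

lemma mem_saSet {m N : ℕ} {d : Fin m → ℕ} :
    d ∈ saSet m N ↔ (∀ i, d i < N) ∧ StrictAnti d := by
  simp [saSet]

lemma mem_atSet {m N : ℕ} {d : Fin m → ℕ} :
    d ∈ atSet m N ↔ (∀ i, d i < N) ∧ Antitone d := by
  simp [atSet]

lemma strictAnti_cons {m : ℕ} {N : ℕ} {d : Fin m → ℕ} :
    StrictAnti (Fin.cons N d : Fin (m + 1) → ℕ) ↔ (∀ i, d i < N) ∧ StrictAnti d := by
  constructor
  · intro h
    refine ⟨fun i => ?_, fun i j hij => ?_⟩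
    · have := h (Fin.succ_pos i)
      simpa using this
    · have := h (Fin.succ_lt_succ_iff.mpr hij)
      simpa using this
  · rintro ⟨h1, h2⟩ i j hij
    induction j using Fin.cases with
    | zero => exact absurd hij (Fin.not_lt_zero i)
    | succ j =>
      induction i using Fin.cases with
      | zero => simpa using h1 j
      | succ i => simpa using h2 (Fin.succ_lt_succ_iff.mp hij)

lemma saSet_succ_sum {A : Type*} [AddCommMonoid A] (m N : ℕ) (f : (Fin (m + 1) → ℕ) → A) :
    ∑ d ∈ saSet (m + 1) (N + 1), f d
      = ∑ d ∈ saSet (m + 1) N, f d + ∑ d ∈ saSet m N, f (Fin.cons N d) := by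
  rw [← Finset.sum_filter_not_add_sum_filter (saSet (m + 1) (N + 1)) (fun d => d 0 = N)]
  congr 1
  · apply Finset.sum_congr _ (fun _ _ => rfl)
    ext d
    simp only [Finset.mem_filter, mem_saSet]
    constructor
    · rintro ⟨⟨h1, h2⟩, h3⟩
      refine ⟨fun i => ?_, h2⟩
      have := h2.antitone (Fin.zero_le i)
      have := h1 0
      omega
    · rintro ⟨h1, h2⟩
      exact ⟨⟨fun i => (h1 i).trans (Nat.lt_succ_self N), h2⟩, (h1 0).ne⟩
  · symm
    apply Finset.sum_bij (fun d _ => (Fin.cons N d : Fin (m + 1) → ℕ))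
    · intro d hd
      rw [mem_saSet] at hd
      simp only [Finset.mem_filter, mem_saSet]
      refine ⟨⟨fun i => ?_, strictAnti_cons.mpr hd⟩, by simp⟩
      induction i using Fin.cases with
      | zero => simp
      | succ i => simpa using (hd.1 i).trans (Nat.lt_succ_self N)
    · intro a _ b _ h
      exact Fin.cons_right_injective (α := fun _ => ℕ) N h
    · intro d hd
      simp only [Finset.mem_filter, mem_saSet] at hd
      obtain ⟨⟨_, h2⟩, h3⟩ := hd
      have hd' : (Fin.cons N (Fin.tail d) : Fin (m + 1) → ℕ) = d := by
        rw [← h3]; exact Fin.cons_self_tail d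
      refine ⟨Fin.tail d, ?_, hd'⟩
      rw [mem_saSet, ← strictAnti_cons, hd']
      exact h2
    · intros; rfl

section Ext
variable {R M : Type*} [CommRing R] [AddCommGroup M] [Module R M]

/-- sum of the wedges over strictly decreasing tuples -/
def wedgeSum (R : Type*) {M : Type*} [CommRing R] [AddCommGroup M] [Module R M]
    (x : ℕ → M) (m N : ℕ) : ExteriorAlgebra R M :=
  ∑ d ∈ saSet m N, ExteriorAlgebra.ιMulti R m (x ∘ d)

lemma ιMulti_cons {m : ℕ} (a : M) (y : Fin m → M) :
    ExteriorAlgebra.ιMulti R (m + 1) (Fin.cons a y)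
      = ExteriorAlgebra.ι R a * ExteriorAlgebra.ιMulti R m y := by
  rw [ExteriorAlgebra.ιMulti_succ_apply]
  simp [Matrix.vecTail, Function.comp_def]

lemma comp_cons' {M : Type*} (x : ℕ → M) {m : ℕ} (a : ℕ) (y : Fin m → ℕ) :
    x ∘ (Fin.cons a y : Fin (m + 1) → ℕ) = Fin.cons (x a) (x ∘ y) := by
  ext i
  induction i using Fin.cases <;> simp

lemma wedgeSum_succ_succ (x : ℕ → M) (m N : ℕ) :
    wedgeSum R x (m + 1) (N + 1)
      = wedgeSum R x (m + 1) N + ExteriorAlgebra.ι R (x N) * wedgeSum R x m N := by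
  unfold wedgeSum
  rw [saSet_succ_sum, Finset.mul_sum]
  simp only [comp_cons', ιMulti_cons]

lemma wedgeSum_zero (x : ℕ → M) (N : ℕ) : wedgeSum R x 0 N = 1 := by
  have : saSet 0 N = {Fin.elim0} := by
    ext d
    simp [mem_saSet, Subsingleton.elim d Fin.elim0, StrictAnti]
  simp [wedgeSum, this]

lemma wedgeSum_succ_zero (x : ℕ → M) (m : ℕ) : wedgeSum R x (m + 1) 0 = 0 := by
  have : saSet (m + 1) 0 = ∅ := by
    ext d
    simp [mem_saSet]
  simp [wedgeSum, this]

lemma wedgeSum_odd (x : ℕ → M) (N : ℕ) : ∀ k : ℕ,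
    wedgeSum R x (2 * k + 1) N
      = ExteriorAlgebra.ι R (∑ j ∈ Finset.range N, x j) * wedgeSum R x (2 * k) N := by
  induction N with
  | zero => intro k; simp [wedgeSum_succ_zero]
  | succ N ih =>
    intro k
    rw [wedgeSum_succ_succ, ih k, Finset.sum_range_succ, map_add]
    cases k with
    | zero => simp [wedgeSum_zero]
    | succ k =>
      rw [show 2 * (k + 1) = (2 * k + 1) + 1 by ring, wedgeSum_succ_succ, ih k]
      set X := ExteriorAlgebra.ι R (∑ j ∈ Finset.range N, x j)
      set y := ExteriorAlgebra.ι R (x N)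
      have hX : X * X = 0 := ExteriorAlgebra.ι_sq_zero _
      have hy : y * y = 0 := ExteriorAlgebra.ι_sq_zero _
      have hXy : X * y = - (y * X) :=
        eq_neg_of_add_eq_zero_left (ExteriorAlgebra.ι_add_mul_swap _ _)
      have e1 : X * (y * (X * wedgeSum R x (2 * k) N)) = 0 := by
        rw [← mul_assoc, hXy, neg_mul, mul_assoc, ← mul_assoc X, hX]; simp
      have e2 : y * (y * (X * wedgeSum R x (2 * k) N)) = 0 := by
        rw [← mul_assoc, hy]; simp
      rw [add_mul, mul_add, mul_add, e1, e2]
      simp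
end Ext

/-- The determinant identity. -/
lemma sum_det_odd {R : Type*} [CommRing R] (k N : ℕ)
    (x : ℕ → Fin (2 * k + 1) → R) :
    ∑ d ∈ atSet (2 * k + 1) N, Matrix.det (Matrix.of fun j i => x (d j) i)
      = ∑ d ∈ saSet (2 * k) N, Matrix.det
          (Matrix.of (Fin.cons (∑ j ∈ Finset.range N, x j) (x ∘ d) :
            Fin (2 * k + 1) → Fin (2 * k + 1) → R)) := by
  have h1 : ∑ d ∈ atSet (2 * k + 1) N, Matrix.det (Matrix.of fun j i => x (d j) i)
      = ∑ d ∈ saSet (2 * k + 1) N, Matrix.det (Matrix.of fun j i => x (d j) i) := by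
    symm
    apply Finset.sum_subset
    · intro d hd
      rw [mem_saSet] at hd
      exact mem_atSet.mpr ⟨hd.1, hd.2.antitone⟩
    · intro d hd hd'
      rw [mem_atSet] at hd
      rw [mem_saSet] at hd'
      have : ¬ Function.Injective d := fun h => hd' ⟨hd.1, hd.2.strictAnti_of_injective h⟩
      simp only [Function.Injective, not_forall] at this
      obtain ⟨a, b, hab, hne⟩ := this
      exact Matrix.det_zero_of_row_eq hne (by ext i; simp [hab])
  rw [h1]
  have h2 := wedgeSum_odd (R := R) x N k
  let f : ∀ i, (Fin (2 * k + 1) → R) [⋀^Fin i]→ₗ[R] R := fun i =>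
    if h : i = 2 * k + 1 then h ▸ Matrix.detRowAlternating else 0
  have hf : f (2 * k + 1) = Matrix.detRowAlternating := by simp [f]
  have h3 := congrArg (ExteriorAlgebra.liftAlternating (R := R) f) h2
  unfold wedgeSum at h3
  rw [Finset.mul_sum, map_sum, map_sum] at h3
  simp only [← ιMulti_cons, ExteriorAlgebra.liftAlternating_apply_ιMulti, hf] at h3
  exact h3

lemma valuation_det_le {R Γ : Type*} [CommRing R] [LinearOrderedCommGroupWithZero Γ]
    (w : Valuation R Γ) {m : ℕ} (a : Fin (m + 1) → R) (y : Fin m → Fin (m + 1) → R) (ε : Γ)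
    (ha : ∀ i, w (a i) < ε) (hε : ε ≠ 0) (hy : ∀ j i, w (y j i) ≤ 1) :
    w (Matrix.det (Matrix.of (Fin.cons a y : Fin (m + 1) → Fin (m + 1) → R))) < ε := by
  rw [Matrix.det_succ_row _ 0]
  apply w.map_sum_lt hε
  intro i _
  have h1 : w ((Matrix.submatrix (Matrix.of (Fin.cons a y : Fin (m + 1) → Fin (m + 1) → R))
      (Fin.succAbove 0) i.succAbove).det) ≤ 1 := by
    rw [Matrix.det_apply]
    apply w.map_sum_le
    intro σ _
    have h2 : w (∏ j, (Matrix.submatrix (Matrix.of (Fin.cons a y : Fin (m + 1) → Fin (m + 1) → R))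
      (Fin.succAbove 0) i.succAbove) (σ j) j) ≤ 1 := by
      rw [map_prod]
      apply Finset.prod_le_one'
      intro j _
      simpa using hy _ _
    rcases Int.units_eq_one_or (Equiv.Perm.sign σ) with h | h <;> rw [h]
    · simpa using h2
    · rw [Units.neg_smul, Valuation.map_neg]; simpa using h2
  rw [map_mul, map_mul]
  have h3 : w ((-1 : R) ^ ((0 : Fin (m + 1)) + i : ℕ)) = 1 := by
    rw [map_pow, Valuation.map_neg, map_one, one_pow]
  rw [h3, one_mul]
  calc _ ≤ w (a i) * 1 := by
        apply mul_le_mul' _ h1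
        simp
    _ < ε := by simpa using ha i

/-! ### Power sums -/

section Pow
variable {F : Type*} [Field F] [Fintype F]

lemma finite_degree_lt (N : ℕ) : {a : Polynomial F | a.degree < N}.Finite := by
  have : Finite (Polynomial.degreeLT F N) :=
    Finite.of_equiv _ (Polynomial.degreeLTEquiv F N).toEquiv.symm
  have h := Set.toFinite ((Polynomial.degreeLT F N : Set (Polynomial F)))
  refine h.subset ?_
  intro a ha
  exact Polynomial.mem_degreeLT.mpr ha

/-- polynomials of degree `< N` prime to `v` -/
def tSet (v : Polynomial F) (N : ℕ) : Finset (Polynomial F) :=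
  (finite_degree_lt (F := F) N).toFinset.filter fun a => ¬ v ∣ a

/-- monic polynomials of degree `< N` prime to `v` -/
def mSet (v : Polynomial F) (N : ℕ) : Finset (Polynomial F) :=
  (tSet v N).filter Polynomial.Monic

lemma mem_tSet {v : Polynomial F} {N : ℕ} {a : Polynomial F} :
    a ∈ tSet v N ↔ a.degree < N ∧ ¬ v ∣ a := by
  simp [tSet]

lemma mem_mSet {v : Polynomial F} {N : ℕ} {a : Polynomial F} :
    a ∈ mSet v N ↔ (a.degree < N ∧ ¬ v ∣ a) ∧ a.Monic := by
  simp [mSet, mem_tSet]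

local notation "ι" => algebraMap (Polynomial F) (RatFunc F)

lemma Stilde_eq (v : Polynomial F) (d : ℕ) (k : ℤ) {N : ℕ} (hd : d < N) :
    Stilde v d k = ∑ a ∈ (mSet v N).filter (fun a => a.natDegree = d), (ι a) ^ (-k) := by
  unfold Stilde
  rw [← finsum_mem_coe_finset]
  apply finsum_mem_congr _ (fun _ _ => rfl)
  ext a
  simp only [Set.mem_ofPred_eq, Finset.coe_filter, mem_mSet]
  constructor
  · rintro ⟨h1, h2, h3⟩
    refine ⟨⟨⟨?_, h3⟩, h1⟩, h2⟩
    rw [Polynomial.degree_eq_natDegree h1.ne_zero, h2]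
    exact_mod_cast hd
  · rintro ⟨⟨⟨_, h3⟩, h1⟩, h2⟩
    exact ⟨h1, h2, h3⟩

lemma sum_Stilde (v : Polynomial F) (k : ℤ) (N : ℕ) :
    ∑ d ∈ Finset.range N, Stilde v d k = ∑ a ∈ mSet v N, (ι a) ^ (-k) := by
  rw [Finset.sum_congr rfl (fun d hd => Stilde_eq v d k (Finset.mem_range.mp hd))]
  apply Finset.sum_fiberwise_of_maps_to
  intro a ha
  rw [mem_mSet] at ha
  rw [Finset.mem_range]
  have := ha.1.1
  rw [Polynomial.degree_eq_natDegree ha.2.ne_zero] at this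
  exact_mod_cast this

lemma sum_tSet (v : Polynomial F) (k : ℤ) (N : ℕ)
    (hk : ((Fintype.card F : ℤ) - 1) ∣ k) :
    ∑ a ∈ tSet v N, (ι a) ^ (-k) = - ∑ a ∈ mSet v N, (ι a) ^ (-k) := by
  have hu : ∀ u : Fˣ, (ι (Polynomial.C (u : F))) ^ (-k) = 1 := by
    intro u
    obtain ⟨c, rfl⟩ := hk
    have h1 : u ^ (((Fintype.card F : ℤ) - 1)) = 1 := by
      have h2 : u ^ (Fintype.card F - 1) = 1 := by
        rw [← Fintype.card_units]; exact pow_card_eq_one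
      have h3 : ((Fintype.card F : ℤ) - 1) = ((Fintype.card F - 1 : ℕ) : ℤ) := by
        have := Fintype.card_pos (α := F)
        omega
      rw [h3, zpow_natCast, h2]
    have h4 : (u : F) ^ (-(((Fintype.card F : ℤ) - 1) * c)) = 1 := by
      rw [← Units.val_zpow_eq_zpow_val, ← mul_neg, zpow_mul, h1]; simp
    have h5 := map_zpow₀ ((algebraMap (Polynomial F) (RatFunc F)).comp Polynomial.C) (u : F)
      (-(((Fintype.card F : ℤ) - 1) * c))
    rw [h4, map_one] at h5
    simpa using h5.symm
  have h : ∑ a ∈ tSet v N, (ι a) ^ (-k)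
      = ∑ p ∈ (Finset.univ : Finset Fˣ) ×ˢ mSet v N, (ι p.2) ^ (-k) := by
    symm
    apply Finset.sum_bij (fun p _ => Polynomial.C (p.1 : F) * p.2)
    · rintro ⟨u, a⟩ hp
      simp only [Finset.mem_product, Finset.mem_univ, true_and, mem_mSet] at hp
      rw [mem_tSet]
      refine ⟨?_, ?_⟩
      · rw [Polynomial.degree_C_mul u.ne_zero]; exact hp.1.1
      · intro h
        apply hp.1.2
        have : a = Polynomial.C ((u⁻¹ : Fˣ) : F) * (Polynomial.C (u : F) * a) := by
          rw [← mul_assoc, ← Polynomial.C_mul]; simp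
        rw [this]
        exact h.mul_left _
    · rintro ⟨u, a⟩ hp ⟨u', a'⟩ hp' h
      simp only [Finset.mem_product, Finset.mem_univ, true_and, mem_mSet] at hp hp' h
      have h1 := congrArg Polynomial.leadingCoeff h
      simp only [Polynomial.leadingCoeff_mul, Polynomial.leadingCoeff_C, hp.2.leadingCoeff,
        hp'.2.leadingCoeff, mul_one] at h1
      rw [h1] at h
      have h2 := mul_left_cancel₀ (by simp) h
      rw [Units.ext h1, h2]
    · intro b hb
      rw [mem_tSet] at hb
      have hb0 : b ≠ 0 := fun h => hb.2 (h ▸ dvd_zero v)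
      have hl : b.leadingCoeff ≠ 0 := Polynomial.leadingCoeff_ne_zero.mpr hb0
      refine ⟨(Units.mk0 _ hl, Polynomial.C b.leadingCoeff⁻¹ * b), ?_, ?_⟩
      · simp only [Finset.mem_product, Finset.mem_univ, true_and, mem_mSet]
        refine ⟨⟨?_, ?_⟩, ?_⟩
        · rw [Polynomial.degree_C_mul (inv_ne_zero hl)]; exact hb.1
        · intro h
          apply hb.2
          have : b = Polynomial.C b.leadingCoeff * (Polynomial.C b.leadingCoeff⁻¹ * b) := by
            rw [← mul_assoc, ← Polynomial.C_mul, mul_inv_cancel₀ hl]; simp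
          rw [this]
          exact h.mul_left _
        · simp [Polynomial.Monic, hl]
      · simp only [Units.val_mk0]
        rw [← mul_assoc, ← Polynomial.C_mul, mul_inv_cancel₀ hl]; simp
    · rintro ⟨u, a⟩ _
      simp only [map_mul, mul_zpow, hu, one_mul]
  rw [h, Finset.sum_product]
  simp only [Finset.sum_const, Finset.card_univ, nsmul_eq_mul]
  have hc : ((Fintype.card Fˣ : ℕ) : RatFunc F) = -1 := by
    rw [Fintype.card_units, Nat.cast_sub Fintype.card_pos]
    have : ((Fintype.card F : ℕ) : RatFunc F) = 0 := by
      have := congrArg (algebraMap F (RatFunc F)) (FiniteField.cast_card_eq_zero F)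
      rwa [map_natCast, map_zero] at this
    rw [this]; simp
  rw [hc]; ring

lemma card_tSet_zero (v : Polynomial F) (hvm : v.Monic) (hv : Irreducible v) (m : ℕ) (hm : 2 ≤ m) :
    (((tSet v (m * v.natDegree)).card : ℕ) : F) = 0 := by
  have hpos := hv.natDegree_pos
  set T := tSet v (m * v.natDegree)
  have key : ∑ a ∈ T, (a + v).coeff v.natDegree = ∑ a ∈ T, a.coeff v.natDegree := by
    have hdv : v.degree < ((m * v.natDegree : ℕ) : WithBot ℕ) := by
      rw [Polynomial.degree_eq_natDegree hvm.ne_zero]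
      have : v.natDegree < m * v.natDegree := by nlinarith
      exact_mod_cast this
    apply Finset.sum_bij (fun a _ => a + v)
    · intro a ha
      rw [mem_tSet] at ha ⊢
      exact ⟨(Polynomial.degree_add_le _ _).trans_lt (max_lt ha.1 hdv),
        by rw [dvd_add_self_right]; exact ha.2⟩
    · intro a _ b _ h; exact add_right_cancel h
    · intro b hb
      rw [mem_tSet] at hb
      refine ⟨b - v, ?_, by simp⟩
      rw [mem_tSet]
      exact ⟨(Polynomial.degree_sub_le _ _).trans_lt (max_lt hb.1 hdv),
        by rw [dvd_sub_self_right]; exact hb.2⟩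
    · intros; rfl
  simp only [Polynomial.coeff_add, Finset.sum_add_distrib, Polynomial.coeff_natDegree,
    hvm.leadingCoeff, Finset.sum_const, nsmul_eq_mul, mul_one] at key
  simpa using key

lemma valuation_zpow_sub {K Γ : Type*} [Field K] [LinearOrderedCommGroupWithZero Γ]
    (w : Valuation K Γ) (ε : Γ) (x y : K) (hx : w x = 1) (hy : w y = 1) (h : w (x - y) ≤ ε)
    (k : ℤ) : w (x ^ k - y ^ k) ≤ ε := by
  have hn : ∀ (n : ℕ), w (x ^ n - y ^ n) ≤ ε := by
    intro n
    induction n with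
    | zero => simp
    | succ n ih =>
      have : x ^ (n + 1) - y ^ (n + 1) = x * (x ^ n - y ^ n) + (x - y) * y ^ n := by ring
      rw [this]
      apply w.map_add_le
      · rw [map_mul, hx, one_mul]; exact ih
      · rw [map_mul, map_pow, hy, one_pow, mul_one]; exact h
  have hx0 : x ≠ 0 := fun h => by simp [h] at hx
  have hy0 : y ≠ 0 := fun h => by simp [h] at hy
  obtain ⟨n, rfl | rfl⟩ := k.eq_nat_or_neg
  · simpa using hn n
  · have : x ^ (-(n : ℤ)) - y ^ (-(n : ℤ)) = - ((x ^ n - y ^ n) * (x ^ n)⁻¹ * (y ^ n)⁻¹) := by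
      rw [zpow_neg, zpow_neg, zpow_natCast, zpow_natCast]
      field_simp
      ring
    rw [this, Valuation.map_neg, map_mul, map_mul, map_inv₀, map_inv₀, map_pow, map_pow, hx, hy]
    simpa using hn n

/-- the `v`-adic valuation on `F(t)` -/
abbrev vval (v : Polynomial F) (hv : Irreducible v) :=
  (heightOneOf v hv).valuation (RatFunc F)

lemma vval_eq_one (v : Polynomial F) (hv : Irreducible v) {a : Polynomial F} (ha : ¬ v ∣ a) :
    vval v hv (ι a) = 1 := by
  rw [IsDedekindDomain.HeightOneSpectrum.valuation_eq_one_iff_notMem]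
  simpa [heightOneOf, Ideal.mem_span_singleton] using ha

lemma vval_le_pow (v : Polynomial F) (hv : Irreducible v) {a : Polynomial F} (m : ℕ)
    (ha : v ^ m ∣ a) : vval v hv (ι a) ≤ (vval v hv (ι v)) ^ m := by
  obtain ⟨b, rfl⟩ := ha
  rw [map_mul, map_mul, map_pow, map_pow]
  exact mul_le_of_le_one_right' (IsDedekindDomain.HeightOneSpectrum.valuation_le_one _ _)

lemma vval_self_lt (v : Polynomial F) (hv : Irreducible v) : vval v hv (ι v) < 1 := by
  rw [IsDedekindDomain.HeightOneSpectrum.valuation_lt_one_iff_mem]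
  simp [heightOneOf]

lemma main_bound (v : Polynomial F) (hvm : v.Monic) (hv : Irreducible v) (k : ℤ) (m : ℕ) :
    vval v hv (((ι (1 + v)) ^ k - 1) * ∑ a ∈ tSet v (m * v.natDegree), (ι a) ^ k)
      ≤ (vval v hv (ι v)) ^ m := by
  set T := tSet v (m * v.natDegree)
  have hmon : (v ^ m).Monic := hvm.pow m
  have hdeg : (v ^ m).degree = ((m * v.natDegree : ℕ) : WithBot ℕ) := by
    rw [Polynomial.degree_eq_natDegree hmon.ne_zero, hvm.natDegree_pow]
  have hc : ¬ v ∣ 1 + v := by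
    rw [dvd_add_self_right]; exact hv.not_dvd_one
  have hsub : ∀ b : Polynomial F, v ^ m ∣ b - b %ₘ v ^ m := by
    intro b
    exact ⟨b /ₘ v ^ m, by rw [sub_eq_iff_eq_add']; exact (Polynomial.modByMonic_add_div b _).symm⟩
  rcases Nat.eq_zero_or_pos m with hm | hm
  · have hT : T = ∅ := by
      ext a
      simp only [T, mem_tSet, hm]
      simp only [zero_mul, Nat.cast_zero, Finset.notMem_empty, iff_false, not_and, not_not]
      intro h
      have : a = 0 := by
        by_contra h0
        rw [Polynomial.degree_eq_natDegree h0] at h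
        norm_cast at h
      simp [this]
    simp [hT]
  have hvd : ∀ b : Polynomial F, v ∣ b %ₘ v ^ m → v ∣ b := by
    intro b hb
    have := (dvd_pow_self v hm.ne').trans (hsub b)
    exact (dvd_sub_left hb).mp this
  have hmaps : ∀ a ∈ T, ((1 + v) * a) %ₘ v ^ m ∈ T := by
    intro a ha
    rw [mem_tSet] at ha ⊢
    refine ⟨hdeg ▸ Polynomial.degree_modByMonic_lt _ hmon, fun h => ?_⟩
    rcases hv.prime.dvd_or_dvd (hvd _ h) with h | h
    · exact hc h
    · exact ha.2 h
  have hinj : Set.InjOn (fun a => ((1 + v) * a) %ₘ v ^ m) (T : Set (Polynomial F)) := by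
    intro a ha b hb h
    simp only at h
    have ha' := (mem_tSet.mp ha).1
    have hb' := (mem_tSet.mp hb).1
    have h1 : v ^ m ∣ (1 + v) * (a - b) := by
      have := dvd_sub (hsub ((1 + v) * a)) (hsub ((1 + v) * b))
      rw [h] at this
      convert this using 1
      ring
    have hcop : IsCoprime (v ^ m) (1 + v) := by
      apply IsCoprime.pow_left
      exact ⟨-1, 1, by ring⟩
    have h2 := hcop.dvd_of_dvd_mul_left h1
    have h3 : a - b = 0 := by
      apply Polynomial.eq_zero_of_dvd_of_degree_lt h2
      rw [hdeg]
      exact (Polynomial.degree_sub_le _ _).trans_lt (max_lt ha' hb')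
    exact sub_eq_zero.mp h3
  have hsurj : Set.SurjOn (fun a => ((1 + v) * a) %ₘ v ^ m) (T : Set (Polynomial F)) T :=
    Finset.surjOn_of_injOn_of_card_le _ hmaps hinj le_rfl
  have hre : ∑ a ∈ T, (ι (((1 + v) * a) %ₘ v ^ m)) ^ k = ∑ a ∈ T, (ι a) ^ k :=
    Finset.sum_nbij (fun a => ((1 + v) * a) %ₘ v ^ m) hmaps hinj hsurj (fun _ _ => rfl)
  have heq : ((ι (1 + v)) ^ k - 1) * ∑ a ∈ T, (ι a) ^ k
      = ∑ a ∈ T, ((ι ((1 + v) * a)) ^ k - (ι (((1 + v) * a) %ₘ v ^ m)) ^ k) := by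
    rw [Finset.sum_sub_distrib, hre, sub_mul, one_mul, Finset.mul_sum]
    congr 1
    apply Finset.sum_congr rfl
    intro a _
    rw [map_mul, mul_zpow]
  rw [heq]
  apply Valuation.map_sum_le
  intro a ha
  apply valuation_zpow_sub
  · apply vval_eq_one
    intro h
    rcases hv.prime.dvd_or_dvd h with h | h
    · exact hc h
    · exact (mem_tSet.mp ha).2 h
  · exact vval_eq_one v hv (mem_tSet.mp (hmaps a ha)).2
  · rw [← map_sub]
    exact vval_le_pow v hv m (hsub _)

lemma zpow_ne_one_aux (v : Polynomial F) (hv : Irreducible v) (k : ℤ) (hk : k ≠ 0) :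
    (ι (1 + v)) ^ k - 1 ≠ 0 := by
  have hpos := hv.natDegree_pos
  have hd : (1 + v).natDegree = v.natDegree := by
    rw [add_comm, ← Polynomial.C_1, Polynomial.natDegree_add_C]
  have hn : ∀ n : ℕ, n ≠ 0 → (ι (1 + v)) ^ n ≠ 1 := by
    intro n hn h
    rw [← map_pow, ← map_one (algebraMap (Polynomial F) (RatFunc F))] at h
    have h1 := IsFractionRing.injective (Polynomial F) (RatFunc F) h
    have h2 := congrArg Polynomial.natDegree h1
    rw [Polynomial.natDegree_pow, hd, Polynomial.natDegree_one] at h2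
    rcases Nat.mul_eq_zero.mp h2 with h | h <;> omega
  rw [sub_ne_zero]
  obtain ⟨n, rfl | rfl⟩ := k.eq_nat_or_neg
  · rw [zpow_natCast]; exact hn n (by simpa using hk)
  · rw [zpow_neg, zpow_natCast, ne_eq, inv_eq_one]; exact hn n (by simpa using hk)

lemma eventually_small (v : Polynomial F) (hvm : v.Monic) (hv : Irreducible v) (k : ℤ)
    (hk : ((Fintype.card F : ℤ) - 1) ∣ k) (γ : WithZero (Multiplicative ℤ)) (hγ : γ ≠ 0) :
    ∀ᶠ m in Filter.atTop,
      vval v hv (∑ d ∈ Finset.range (m * v.natDegree), Stilde v d k) < γ := by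
  have hX : ∀ N, vval v hv (∑ d ∈ Finset.range N, Stilde v d k)
      = vval v hv (∑ a ∈ tSet v N, (ι a) ^ (-k)) := by
    intro N
    rw [sum_Stilde, sum_tSet v k N hk, Valuation.map_neg]
  simp only [hX]
  by_cases hk0 : k = 0
  · filter_upwards [Filter.eventually_ge_atTop 2] with m hm
    have h := congrArg (algebraMap F (RatFunc F)) (card_tSet_zero v hvm hv m hm)
    simp only [map_natCast, map_zero] at h
    simp only [hk0, neg_zero, zpow_zero, Finset.sum_const, nsmul_eq_mul, mul_one, h, map_zero]
    exact zero_lt_iff.mpr hγ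
  · have hδ : vval v hv ((ι (1 + v)) ^ (-k) - 1) ≠ 0 :=
      (Valuation.ne_zero_iff _).mpr (zpow_ne_one_aux v hv (-k) (by simpa using hk0))
    set δ := vval v hv ((ι (1 + v)) ^ (-k) - 1)
    obtain ⟨M, hM⟩ := exists_pow_lt₀ (vval_self_lt v hv) (Units.mk0 (δ * γ) (mul_ne_zero hδ hγ))
    filter_upwards [Filter.eventually_ge_atTop M] with m hm
    have h := main_bound v hvm hv (-k) m
    rw [map_mul] at h
    have h2 : vval v hv (ι v) ^ m ≤ vval v hv (ι v) ^ M :=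
      pow_le_pow_right_of_le_one' (vval_self_lt v hv).le hm
    have h3 := (h.trans h2).trans_lt hM
    rw [Units.val_mk0] at h3
    exact lt_of_mul_lt_mul_left' h3

lemma Stilde_le_one (v : Polynomial F) (hv : Irreducible v) (d : ℕ) (k : ℤ) :
    vval v hv (Stilde v d k) ≤ 1 := by
  rw [Stilde_eq v d k (Nat.lt_succ_self d)]
  apply Valuation.map_sum_le
  intro a ha
  rw [Finset.mem_filter, mem_mSet] at ha
  rw [map_zpow₀, vval_eq_one v hv ha.1.1.2, one_zpow]

end Pow

/-! ### Topology -/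

section Top
variable {F : Type*} [Field F]

instance instTAG (v : Polynomial F) (hv : Irreducible v) : IsTopologicalRing (Kv v hv) :=
  inferInstanceAs (IsTopologicalRing ((heightOneOf v hv).adicCompletion (RatFunc F)))

instance instT2 (v : Polynomial F) (hv : Irreducible v) : T2Space (Kv v hv) :=
  inferInstanceAs (T2Space ((heightOneOf v hv).adicCompletion (RatFunc F)))

lemma tendsto_zero_of_vval (v : Polynomial F) (hv : Irreducible v) (u : ℕ → RatFunc F)
    (h : ∀ γ : WithZero (Multiplicative ℤ), γ ≠ 0 → ∀ᶠ m in Filter.atTop,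
      (heightOneOf v hv).valuation (RatFunc F) (u m) < γ) :
    Filter.Tendsto (fun m => algebraMap (RatFunc F) (Kv v hv) (u m)) Filter.atTop (nhds 0) := by
  change Filter.Tendsto (fun m => algebraMap (RatFunc F)
    ((heightOneOf v hv).adicCompletion (RatFunc F)) (u m)) Filter.atTop (nhds 0)
  rw [(Valued.hasBasis_nhds_zero _ _).tendsto_right_iff]
  intro γ _
  have hγ : MonoidWithZeroHom.ValueGroup₀.embedding γ.1 ≠ 0 := by
    simp
  filter_upwards [h _ hγ] with m hm
  rw [Valuation.restrict_lt_iff_lt_embedding]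
  have := IsDedekindDomain.HeightOneSpectrum.valuedAdicCompletion_eq_valuation'
    (heightOneOf v hv) (u m)
  rw [← this] at hm
  exact hm

lemma tendsto_zetavStar (v : Polynomial F) (hv : Irreducible v) (w : List ℤ)
    (hs : Summable (zetavStarTerm v hv w)) :
    Filter.Tendsto (fun N => algebraMap (RatFunc F) (Kv v hv)
      (∑ d ∈ atSet w.length N, ∏ i, Stilde v (d i) (w.get i))) Filter.atTop
      (nhds (zetavStar v hv w)) := by
  have h1 : HasSum (zetavStarTerm v hv w) (zetavStar v hv w) := hs.hasSum
  have h2 : Filter.Tendsto (fun N => (atSet w.length N).subtype Antitone)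
      Filter.atTop Filter.atTop := by
    apply Filter.tendsto_atTop_finset_of_monotone
    · intro N N' h d
      simp only [Finset.mem_subtype, mem_atSet]
      exact fun hd => ⟨fun i => (hd.1 i).trans_le h, hd.2⟩
    · intro d
      refine ⟨(∑ i, d.1 i) + 1, ?_⟩
      simp only [Finset.mem_subtype, mem_atSet]
      exact ⟨fun i => Nat.lt_succ_of_le
        (Finset.single_le_sum (f := d.1) (fun _ _ => Nat.zero_le _) (Finset.mem_univ i)), d.2⟩
  refine (h1.comp h2).congr fun N => ?_
  simp only [Function.comp_apply, zetavStarTerm]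
  rw [map_sum]
  exact Finset.sum_subtype_of_mem
    (fun d : Fin w.length → ℕ => algebraMap (RatFunc F) (Kv v hv) (∏ i, Stilde v (d i) (w.get i)))
    (fun d hd => (mem_atSet.mp hd).2)

lemma sum_cast_list (v : Polynomial F) (w : List ℤ) (n : ℕ) (h : w.length = n) (N : ℕ) :
    ∑ d ∈ atSet w.length N, ∏ i, Stilde v (d i) (w.get i)
      = ∑ d ∈ atSet n N, ∏ i, Stilde v (d i) (w.get (Fin.cast h.symm i)) := by
  subst h; rfl

lemma sum_ofFn (v : Polynomial F) (n : ℕ) (f : Fin n → ℤ) (N : ℕ) :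
    ∑ d ∈ atSet (List.ofFn f).length N, ∏ i, Stilde v (d i) ((List.ofFn f).get i)
      = ∑ d ∈ atSet n N, ∏ i, Stilde v (d i) (f i) := by
  rw [sum_cast_list v _ n (List.length_ofFn)]
  simp

end Top

theorem statement4 {F : Type*} [Field F] [Fintype F] (q : ℕ) (hq : Fintype.card F = q)
    (v : Polynomial F) (hvmonic : v.Monic) (hv : Irreducible v)
    (n : ℕ) (hodd : Odd n) (hpos : 0 < n)
    (s : Fin n → ℤ) (hinj : Function.Injective s)
    (heven : ∀ i, ((q : ℤ) - 1) ∣ s i)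
    (hsum : ∀ σ : Equiv.Perm (Fin n), Summable (zetavStarTerm v hv (List.ofFn (s ∘ σ)))) :
    ∑ σ : Equiv.Perm (Fin n),
      (Equiv.Perm.sign σ : ℤ) • zetavStar v hv (List.ofFn (s ∘ σ)) = 0 := by
  obtain ⟨k, rfl⟩ := hodd
  subst hq
  set x : ℕ → Fin (2 * k + 1) → RatFunc F := fun d i => Stilde v d (s i) with hx
  -- truncated sums
  have hA : ∀ N, ∑ σ : Equiv.Perm (Fin (2 * k + 1)), (Equiv.Perm.sign σ : ℤ) •
      (∑ d ∈ atSet (2 * k + 1) N, ∏ i, Stilde v (d i) ((s ∘ σ) i))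
      = ∑ d ∈ saSet (2 * k) N, Matrix.det
          (Matrix.of (Fin.cons (∑ j ∈ Finset.range N, x j) (x ∘ d) :
            Fin (2 * k + 1) → Fin (2 * k + 1) → RatFunc F)) := by
    intro N
    rw [← sum_det_odd]
    simp only [Finset.smul_sum]
    rw [Finset.sum_comm]
    apply Finset.sum_congr rfl
    intro d _
    rw [← Matrix.det_transpose, Matrix.det_apply]
    apply Finset.sum_congr rfl
    intro σ _
    simp [hx, Units.smul_def]
  have hlim : Filter.Tendsto (fun N => algebraMap (RatFunc F) (Kv v hv)
      (∑ σ : Equiv.Perm (Fin (2 * k + 1)), (Equiv.Perm.sign σ : ℤ) •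
      (∑ d ∈ atSet (2 * k + 1) N, ∏ i, Stilde v (d i) ((s ∘ σ) i)))) Filter.atTop
      (nhds (∑ σ : Equiv.Perm (Fin (2 * k + 1)),
      (Equiv.Perm.sign σ : ℤ) • zetavStar v hv (List.ofFn (s ∘ σ)))) := by
    simp only [map_sum (algebraMap (RatFunc F) (Kv v hv)) _ Finset.univ, map_zsmul]
    apply tendsto_finsetSum
    intro σ _
    have h := tendsto_zetavStar v hv _ (hsum σ)
    simp only [sum_ofFn] at h
    simp only [zsmul_eq_mul]
    exact h.const_mul _
  have hmul : Filter.Tendsto (fun m : ℕ => m * v.natDegree) Filter.atTop Filter.atTop :=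
    Filter.tendsto_id.atTop_mul_const' hv.natDegree_pos
  refine tendsto_nhds_unique (hlim.comp hmul) ?_
  apply tendsto_zero_of_vval v hv
    (fun m => ∑ σ : Equiv.Perm (Fin (2 * k + 1)), (Equiv.Perm.sign σ : ℤ) •
      (∑ d ∈ atSet (2 * k + 1) (m * v.natDegree), ∏ i, Stilde v (d i) ((s ∘ σ) i)))
  intro γ hγ
  have hall := Filter.eventually_all.mpr
    (fun i => eventually_small v hvmonic hv (s i) (heven i) γ hγ)
  filter_upwards [hall] with m hm
  rw [hA]
  apply Valuation.map_sum_lt _ hγ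
  intro d _
  apply valuation_det_le _ _ _ _ _ hγ
  · intro j i
    exact Stilde_le_one v hv _ _
  · intro i
    rw [Finset.sum_apply]
    exact hm i

end
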